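/- The conjugation representation of SL(2, 𝔽₃) on the space Ad⁰(2,𝔽₃) of trace-zero 2×2 matrices over 𝔽₃ is irreducible: the only 𝔽₃-subspaces W of Ad⁰(2,𝔽₃) satisfying g W g⁻¹ ⊆ W for all g ∈ SL(2, 𝔽₃) are the zero subspace and the whole space. -/

import Mathlib

/-- The space `Ad⁰(2,𝔽₃)` of trace-zero `2 × 2` matrices over `𝔽₃`. -/
def Ad0 : Submodule (ZMod 3) (Matrix (Fin 2) (Fin 2) (ZMod 3)) where
  carrier := {B | Matrix.trace B = 0}
  add_mem' := by
    intro a b ha hb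
    simp only [Set.mem_setOf_eq, Matrix.trace_add] at *
    rw [ha, hb, add_zero]
  zero_mem' := by simp
  smul_mem' := by
    intro c x hx
    simp only [Set.mem_setOf_eq, Matrix.trace_smul] at *
    rw [hx, smul_zero]

theorem Matrix.eq_of_trace_fin_two_eq_zero {R : Type*} [AddCommGroup R]
    {B : Matrix (Fin 2) (Fin 2) R} (hB : B.trace = 0) : B = !![B 0 0, B 0 1; B 1 0, -B 0 0] := by
  rw [Matrix.trace_fin_two] at hB
  conv_lhs => rw [Matrix.eta_fin_two B, ← neg_eq_of_add_eq_zero_right hB]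

/-- Stability of a subspace under conjugation by `SL(2,𝔽₃)`. -/
def IsConjStable (W : Submodule (ZMod 3) (Matrix (Fin 2) (Fin 2) (ZMod 3))) : Prop :=
  ∀ g : Matrix.SpecialLinearGroup (Fin 2) (ZMod 3), ∀ B ∈ W,
    (g : Matrix (Fin 2) (Fin 2) (ZMod 3)) * B *
      ((g⁻¹ : Matrix.SpecialLinearGroup (Fin 2) (ZMod 3)) :
        Matrix (Fin 2) (Fin 2) (ZMod 3)) ∈ W

section ConjStable

variable {W : Submodule (ZMod 3) (Matrix (Fin 2) (Fin 2) (ZMod 3))}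

theorem mul_mul_adjugate_mem (hstab : IsConjStable W)
    {M B : Matrix (Fin 2) (Fin 2) (ZMod 3)} (hM : M.det = 1) (hB : B ∈ W) :
    M * B * M.adjugate ∈ W :=
  hstab ⟨M, hM⟩ B hB

/-- Conjugation by the upper unitriangular matrix with entry `t`. -/
theorem upper_unipotent_conj_mem (hstab : IsConjStable W) (t : ZMod 3) {a b c : ZMod 3}
    (h : !![a, b; c, -a] ∈ W) :
    !![a + t * c, b - 2 * t * a - t ^ 2 * c; c, -(a + t * c)] ∈ W := by
  convert mul_mul_adjugate_mem hstab (M := !![1, t; 0, 1]) (by simp) h using 1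
  rw [Matrix.adjugate_fin_two_of]
  ext i j
  fin_cases i <;> fin_cases j <;> simp [Matrix.mul_apply, Fin.sum_univ_two] <;> ring

/-- Conjugation by the Weyl element. -/
theorem weyl_conj_mem (hstab : IsConjStable W) {a b c : ZMod 3}
    (h : !![a, b; c, -a] ∈ W) :
    !![-a, -c; -b, a] ∈ W := by
  convert mul_mul_adjugate_mem hstab (M := !![0, 1; -1, 0]) (by simp) h using 1
  rw [Matrix.adjugate_fin_two_of]
  ext i j
  fin_cases i <;> fin_cases j <;> simp [Matrix.mul_apply, Fin.sum_univ_two]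

/-- A nonzero stable subspace of `Ad0` contains the highest weight vector. -/
theorem upper_nilpotent_mem (hstab : IsConjStable W) (hW : W ≤ Ad0) (hne : W ≠ ⊥) :
    !![0, 1; 0, 0] ∈ W := by
  suffices ∃ x : ZMod 3, x ≠ 0 ∧ !![0, x; 0, 0] ∈ W by
    obtain ⟨x, hx, h⟩ := this
    simpa [hx] using W.smul_mem x⁻¹ h
  obtain ⟨B, hB, hB0⟩ := Submodule.exists_mem_ne_zero_of_ne_bot hne
  have hform := Matrix.eq_of_trace_fin_two_eq_zero (show B.trace = 0 from hW hB)
  generalize B 0 0 = a, B 0 1 = b, B 1 0 = c at hform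
  subst hform
  have hplus := upper_unipotent_conj_mem hstab 1 hB
  have hminus := upper_unipotent_conj_mem hstab (-1) hB
  have three : (3 : ZMod 3) = 0 := rfl
  by_cases hc : c = 0
  · subst hc
    by_cases ha : a = 0
    · subst ha
      refine ⟨b, ?_, by simpa using hB⟩
      rintro rfl
      exact hB0 (by ext i j; fin_cases i <;> fin_cases j <;> rfl)
    · refine ⟨a, ha, ?_⟩
      convert W.sub_mem hplus hB using 1
      ext i j
      fin_cases i <;> fin_cases j <;> simp
      linear_combination a * three
  · refine ⟨c, hc, ?_⟩
    convert W.sub_mem (W.add_mem hplus hminus) (W.smul_mem 2 hB) using 1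
    ext i j
    fin_cases i <;> fin_cases j <;> simp
    · ring
    · linear_combination c * three
    · ring
    · ring

end ConjStable

/-- The conjugation representation of `SL(2,𝔽₃)` on `Ad⁰(2,𝔽₃)` is
irreducible: every `𝔽₃`-subspace `W ⊆ Ad⁰(2,𝔽₃)` that is stable under conjugation by all
of `SL(2,𝔽₃)` is either zero or all of `Ad⁰(2,𝔽₃)`. -/
theorem Ad0_conjugation_irreducible
    (W : Submodule (ZMod 3) (Matrix (Fin 2) (Fin 2) (ZMod 3)))
    (hW : W ≤ Ad0)
    (hstab : ∀ g : Matrix.SpecialLinearGroup (Fin 2) (ZMod 3), ∀ B ∈ W,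
      (g : Matrix (Fin 2) (Fin 2) (ZMod 3)) * B *
        ((g⁻¹ : Matrix.SpecialLinearGroup (Fin 2) (ZMod 3)) :
          Matrix (Fin 2) (Fin 2) (ZMod 3)) ∈ W) :
    W = ⊥ ∨ W = Ad0 := by
  refine or_iff_not_imp_left.mpr fun hne => le_antisymm hW fun B hB => ?_
  have hE := upper_nilpotent_mem hstab hW hne
  have hF : !![0, 0; -1, -0] ∈ W := by
    simpa using weyl_conj_mem hstab (a := 0) (b := 1) (c := 0) (by simpa using hE)
  have hH := upper_unipotent_conj_mem hstab 1 hF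
  rw [Matrix.eq_of_trace_fin_two_eq_zero (show B.trace = 0 from hB)]
  generalize B 0 0 = a, B 0 1 = b, B 1 0 = c
  convert W.add_mem (W.smul_mem (-a) hH)
    (W.add_mem (W.smul_mem (a + b) hE) (W.smul_mem (a - c) hF)) using 1
  ext i j
  fin_cases i <;> fin_cases j <;> simp
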